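/- arXiv:2312.09774 — 3 statements merged into one kernel-verified Lean document; each statement's English description precedes it below -/
import Mathlib

section
/- Suppose δ ≥ 1 is an integer such that ord_0(f_h) ≤ δ for every h ∈ GL_{N+1}(k) (i.e. the multiplicity of H at every point of H(k) is at most δ), and s ≥ −1 is an integer such that the Krull dimension of k[X_0,…,X_N]/J is at most s+1 (i.e. dim(H_sing) ≤ s). If d ≥ δ·min(N+1, s+3), then for every g ∈ GL_{N+1}(k) and every nonzero α = (α_0,…,α_N) ∈ ℤ^{N+1} with Σ_{i=0}^N α_i = 0, one has deg_α(F∘g) ≥ 0; that is, F satisfies the Hilbert–Mumford criterion for semistability, so the hypersurface H is semistable. -/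
open MvPolynomial

/-- The `α`-degree of a multivariate polynomial `G`: the maximum of `∑ i, m i * α i`
over the monomials `X^m` occurring in `G` with nonzero coefficient (0 if `G = 0`). -/
noncomputable def adeg {k : Type*} [CommSemiring k] {n : ℕ} (α : Fin n → ℤ)
    (G : MvPolynomial (Fin n) k) : ℤ :=
  if h : G.support.Nonempty then G.support.sup' h (fun m => ∑ i, (m i : ℤ) * α i) else 0

/-- `F ∘ g`: the polynomial obtained from `F` by the substitution `X i ↦ ∑ j, g i j • X j`. -/
noncomputable def substGL {k : Type*} [CommRing k] {n : ℕ}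
    (g : Matrix (Fin n) (Fin n) k) (F : MvPolynomial (Fin n) k) :
    MvPolynomial (Fin n) k :=
  aeval (fun i => ∑ j, C (g i j) * X j) F

/-- Dehomogenization with respect to the last variable:
`G(X_0, …, X_N) ↦ G(x_0, …, x_{N-1}, 1)`. -/
noncomputable def dehom {k : Type*} [CommRing k] {N : ℕ}
    (G : MvPolynomial (Fin (N+1)) k) : MvPolynomial (Fin N) k :=
  aeval (fun i : Fin (N+1) => if h : (i : ℕ) < N then X ⟨i, h⟩ else 1) G

/-- `ord_0 f`: the minimal total degree of a monomial occurring in `f`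
with nonzero coefficient (0 if `f = 0`). -/
noncomputable def ord0 {k : Type*} [CommSemiring k] {N : ℕ}
    (f : MvPolynomial (Fin N) k) : ℕ :=
  if h : f.support.Nonempty then f.support.inf' h (fun m => ∑ i, m i) else 0

/-- The ideal generated by `F` and its partial derivatives, defining the singular
locus `H_sing` of the hypersurface `H = {F = 0}`. -/
noncomputable def jacobianIdeal {k : Type*} [CommRing k] {N : ℕ}
    (F : MvPolynomial (Fin (N+1)) k) : Ideal (MvPolynomial (Fin (N+1)) k) :=
  Ideal.span ({F} ∪ Set.range (fun i => pderiv i F))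

open Finset in
/-- A monotone sequence on `{0, …, c + t}` whose interior terms pair up to nonpositive sums and
whose smallest term outweighs `t + 1` copies of the largest one has negative sum. -/
theorem sum_range_neg_of_pairing {f : ℕ → ℤ} {c t : ℕ} (hc : 1 ≤ c)
    (hmono : ∀ i ≤ c + t, f i ≤ f (c + t))
    (hpair : ∀ u v, u + v = c → f u + f v ≤ 0)
    (hext : f 0 + (t + 1) * f (c + t) < 0) :
    ∑ i ∈ range (c + t + 1), f i < 0 := by
  obtain ⟨b, rfl⟩ : ∃ b, c = b + 1 := ⟨c - 1, by omega⟩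
  have h1 : ∑ i ∈ range (b + 1 + t + 1), f i =
      ∑ i ∈ range b, f (i + 1) + f 0 + ∑ j ∈ range (t + 1), f (b + 1 + j) := by
    rw [add_assoc (b + 1) t 1, sum_range_add, sum_range_succ']
  have h2 : ∑ j ∈ range (t + 1), f (b + 1 + j) ≤ (t + 1) * f (b + 1 + t) := by
    refine (sum_le_card_nsmul _ _ (f (b + 1 + t)) fun j hj ↦ hmono _ ?_).trans_eq ?_
    · have := mem_range.mp hj
      omega
    · simp
  have h3 : ∑ i ∈ range b, f (i + 1) + ∑ i ∈ range b, f (i + 1) ≤ 0 := by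
    nth_rw 2 [← sum_range_reflect]
    rw [← sum_add_distrib]
    refine sum_nonpos fun i hi ↦ hpair _ _ ?_
    have := mem_range.mp hi
    omega
  linarith

namespace MvPolynomial

variable {k : Type*} [Field k] {n : ℕ}

theorem IsHomogeneous.sum_eq_of_mem_support {G : MvPolynomial (Fin n) k} {d : ℕ}
    (hG : G.IsHomogeneous d) {m : Fin n →₀ ℕ} (hm : m ∈ G.support) : ∑ i, m i = d := by
  rw [← hG (mem_support_iff.mp hm), Pi.one_def, ← Finsupp.degree_eq_weight_one,
    Finsupp.degree_eq_sum]

/-- The substitution `X i ↦ 0` for `i < j`, fixing the other variables. -/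
noncomputable def killBelow (k : Type*) [Field k] (n j : ℕ) :
    MvPolynomial (Fin n) k →ₐ[k] MvPolynomial (Fin n) k :=
  aeval fun i ↦ if (i : ℕ) < j then 0 else X i

theorem killBelow_X (j : ℕ) (i : Fin n) :
    killBelow k n j (X i) = if (i : ℕ) < j then 0 else X i := by
  simp [killBelow]

theorem killBelow_comp {j l : ℕ} (h : j ≤ l) :
    (killBelow k n l).comp (killBelow k n j) = killBelow k n l := by
  refine algHom_ext fun i ↦ ?_
  rw [AlgHom.comp_apply, killBelow_X]
  split_ifs with hi
  · rw [map_zero, killBelow_X, if_pos (by omega)]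
  · rfl

theorem le_height_ker_killBelow {j : ℕ} (hj : j ≤ n) :
    (j : ℕ∞) ≤ (RingHom.ker (killBelow k n j)).height := by
  induction j with
  | zero => simp
  | succ j ih =>
    have hlt : RingHom.ker (killBelow k n j) < RingHom.ker (killBelow k n (j + 1)) := by
      refine lt_of_le_of_ne (fun p hp ↦ ?_) fun h ↦ ?_
      · rw [RingHom.mem_ker] at hp ⊢
        rw [← killBelow_comp (Nat.le_succ j), AlgHom.comp_apply, hp, map_zero]
      · have : X ⟨j, hj⟩ ∈ RingHom.ker (killBelow k n j) := by
          rw [h, RingHom.mem_ker, killBelow_X, if_pos (Nat.lt_succ_self j)]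
        rw [RingHom.mem_ker, killBelow_X, if_neg (lt_irrefl j)] at this
        exact X_ne_zero _ this
    push_cast
    have := RingHom.ker_isPrime (killBelow k n j)
    have := RingHom.ker_isPrime (killBelow k n (j + 1))
    grw [ih (by omega)]
    exact Ideal.height_add_one_le_of_lt_of_isPrime hlt

theorem le_height_ker_constantCoeff :
    (n : ℕ∞) ≤ (RingHom.ker (constantCoeff : MvPolynomial (Fin n) k →+* k)).height := by
  have h : (constantCoeff : MvPolynomial (Fin n) k →+* k).comp
      (killBelow k n n : MvPolynomial (Fin n) k →+* MvPolynomial (Fin n) k) =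
      constantCoeff := by
    refine ringHom_ext (fun a ↦ ?_) fun i ↦ ?_
    · simp
    · rw [RingHom.comp_apply, RingHom.coe_coe, killBelow_X, if_pos i.isLt, map_zero,
        constantCoeff_X]
  refine (le_height_ker_killBelow (k := k) le_rfl).trans (Ideal.height_mono fun p hp ↦ ?_)
  rw [RingHom.mem_ker] at hp ⊢
  rw [← h, RingHom.comp_apply, RingHom.coe_coe, hp, map_zero]

/-- Cutting affine space by `c` equations vanishing at the origin lowers the dimension by
at most `c`. -/
theorem le_ringKrullDim_quotient_add_encard (s : Set (MvPolynomial (Fin n) k))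
    (hs : ∀ p ∈ s, constantCoeff p = 0) :
    (n : WithBot ℕ∞) ≤ ringKrullDim (MvPolynomial (Fin n) k ⧸ Ideal.span s) + s.encard := by
  have := RingHom.ker_isPrime (constantCoeff : MvPolynomial (Fin n) k →+* k)
  refine le_trans ?_ (Ideal.height_le_ringKrullDim_quotient_add_encard
    (p := RingHom.ker (constantCoeff : MvPolynomial (Fin n) k →+* k)) s hs)
  exact WithBot.coe_le_coe.mpr le_height_ker_constantCoeff

end MvPolynomial

section substGL

variable {k : Type*} [Field k] {n : ℕ}

theorem substGL_mul (g h : Matrix (Fin n) (Fin n) k) (F : MvPolynomial (Fin n) k) :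
    substGL (h * g) F = substGL g (substGL h F) := by
  unfold substGL
  rw [← AlgHom.comp_apply]
  congr 1
  refine algHom_ext fun i ↦ ?_
  simp only [aeval_X, AlgHom.comp_apply, map_sum, map_mul, algHom_C, Matrix.mul_apply,
    Finset.sum_mul, Finset.mul_sum, algebraMap_eq]
  rw [Finset.sum_comm]
  simp only [mul_assoc]

theorem substGL_one (F : MvPolynomial (Fin n) k) :
    substGL (1 : Matrix (Fin n) (Fin n) k) F = F := by
  unfold substGL
  conv_rhs => rw [← aeval_X_left_apply F]
  congr 2
  funext i
  simp [Matrix.one_apply]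

theorem substGL_surjective (g : Matrix.GeneralLinearGroup (Fin n) k) :
    Function.Surjective (substGL (g : Matrix (Fin n) (Fin n) k)) := fun p ↦
  ⟨substGL (↑g⁻¹ : Matrix (Fin n) (Fin n) k) p, by
    rw [← substGL_mul, ← Units.val_mul, inv_mul_cancel, Units.val_one, substGL_one]⟩

theorem substGL_injective (g : Matrix.GeneralLinearGroup (Fin n) k) :
    Function.Injective (substGL (g : Matrix (Fin n) (Fin n) k)) :=
  Function.LeftInverse.injective (g := substGL (↑g⁻¹ : Matrix (Fin n) (Fin n) k)) fun p ↦ by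
    rw [← substGL_mul, ← Units.val_mul, mul_inv_cancel, Units.val_one, substGL_one]

theorem substGL_ne_zero (g : Matrix.GeneralLinearGroup (Fin n) k) {F : MvPolynomial (Fin n) k}
    (hF : F ≠ 0) : substGL (g : Matrix (Fin n) (Fin n) k) F ≠ 0 := fun h ↦
  hF (substGL_injective g (h.trans (map_zero (aeval _)).symm))

theorem isHomogeneous_substGL (g : Matrix (Fin n) (Fin n) k) {F : MvPolynomial (Fin n) k} {d : ℕ}
    (hF : F.IsHomogeneous d) : (substGL g F).IsHomogeneous d := by
  have := hF.aeval (fun i ↦ ∑ j, C (g i j) * X j) (n := 1) fun i ↦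
    IsHomogeneous.sum _ _ _ fun j _ ↦ isHomogeneous_C_mul_X _ _
  rwa [one_mul] at this

theorem pderiv_substGL (g : Matrix (Fin n) (Fin n) k) (F : MvPolynomial (Fin n) k) (j : Fin n) :
    pderiv j (substGL g F) = ∑ i, C (g i j) * substGL g (pderiv i F) := by
  classical
  unfold substGL
  induction F using MvPolynomial.induction_on with
  | C a => simp
  | add p q hp hq => simp only [map_add, hp, hq, mul_add, Finset.sum_add_distrib]
  | mul_X p l hp =>
    have hX : pderiv j (∑ x, C (g l x) * X x : MvPolynomial (Fin n) k) = C (g l j) := by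
      simp [pderiv_X, Pi.single_apply]
    have hone : ∀ i, aeval (fun i ↦ ∑ j, C (g i j) * X j)
        (pderiv i (X l : MvPolynomial (Fin n) k)) =
          (if i = l then 1 else 0 : MvPolynomial (Fin n) k) := fun i ↦ by
      rw [pderiv_X, Pi.single_apply, apply_ite (aeval _), map_one, map_zero]
      exact if_congr eq_comm rfl rfl
    simp only [map_mul, pderiv_mul, hp, aeval_X, hX, hone, map_add, mul_add,
      Finset.sum_add_distrib, Finset.sum_mul, mul_ite, mul_one, mul_zero, Finset.sum_ite_eq',
      Finset.mem_univ, if_true, mul_assoc]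
    rw [mul_comm (C (g l j))]

theorem substGL_pderiv (g : Matrix.GeneralLinearGroup (Fin n) k) (F : MvPolynomial (Fin n) k)
    (i : Fin n) :
    substGL (g : Matrix (Fin n) (Fin n) k) (pderiv i F) =
      ∑ j, C ((↑g⁻¹ : Matrix (Fin n) (Fin n) k) j i) *
        pderiv j (substGL (g : Matrix (Fin n) (Fin n) k) F) := by
  have h : ∀ l, ∑ j, (g : Matrix (Fin n) (Fin n) k) l j * (↑g⁻¹ : Matrix (Fin n) (Fin n) k) j i =
      if l = i then 1 else 0 := fun l ↦ by
    rw [← Matrix.mul_apply, ← Units.val_mul, mul_inv_cancel, Units.val_one, Matrix.one_apply]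
  simp only [pderiv_substGL, Finset.mul_sum, ← mul_assoc, ← C_mul]
  rw [Finset.sum_comm]
  simp only [← Finset.sum_mul, ← map_sum, mul_comm _ ((g : Matrix (Fin n) (Fin n) k) _ _), h]
  simp

theorem exists_substGL_eq_rename (g : Matrix.GeneralLinearGroup (Fin n) k)
    (e : Equiv.Perm (Fin n)) :
    ∃ g' : Matrix.GeneralLinearGroup (Fin n) k, ∀ F : MvPolynomial (Fin n) k,
      substGL (g' : Matrix (Fin n) (Fin n) k) F =
        rename e (substGL (g : Matrix (Fin n) (Fin n) k) F) := by
  refine ⟨Matrix.GeneralLinearGroup.mkOfDetNeZero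
    ((g : Matrix (Fin n) (Fin n) k).submatrix id e.symm) ?_, fun F ↦ ?_⟩
  · rw [Matrix.det_permute']
    exact mul_ne_zero (by obtain h | h := Int.units_eq_one_or (Equiv.Perm.sign e) <;> simp [h])
      g.det.ne_zero
  · unfold substGL
    rw [← AlgHom.comp_apply]
    congr 1
    refine algHom_ext fun i ↦ ?_
    simp only [aeval_X, AlgHom.comp_apply, map_sum, map_mul, rename_X, rename_C]
    refine (Equiv.sum_comp e _).symm.trans ?_
    simp [Matrix.GeneralLinearGroup.mkOfDetNeZero]

end substGL

theorem ringKrullDim_quotient_le_of_jacobianIdeal_substGL_le {k : Type*} [Field k] {N : ℕ}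
    (F : MvPolynomial (Fin (N + 1)) k) (g : Matrix.GeneralLinearGroup (Fin (N + 1)) k)
    {I : Ideal (MvPolynomial (Fin (N + 1)) k)}
    (hI : jacobianIdeal (substGL (g : Matrix (Fin (N + 1)) (Fin (N + 1)) k) F) ≤ I) :
    ringKrullDim (MvPolynomial (Fin (N + 1)) k ⧸ I) ≤
      ringKrullDim (MvPolynomial (Fin (N + 1)) k ⧸ jacobianIdeal F) := by
  let φ : MvPolynomial (Fin (N + 1)) k →+* MvPolynomial (Fin (N + 1)) k :=
    (aeval fun i ↦ ∑ j, C ((g : Matrix (Fin (N + 1)) (Fin (N + 1)) k) i j) * X j : _ →ₐ[k] _)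
  have hφ : ∀ p, φ p = substGL (g : Matrix (Fin (N + 1)) (Fin (N + 1)) k) p := fun _ ↦ rfl
  have hle : jacobianIdeal F ≤ RingHom.ker ((Ideal.Quotient.mk I).comp φ) := by
    refine Ideal.span_le.mpr ?_
    have hmem : ∀ p, φ p ∈ I → p ∈ RingHom.ker ((Ideal.Quotient.mk I).comp φ) := fun p hp ↦ by
      rwa [RingHom.mem_ker, RingHom.comp_apply, Ideal.Quotient.eq_zero_iff_mem]
    rintro _ (rfl | ⟨i, rfl⟩)
    · exact hmem _ (hI (Ideal.subset_span (Or.inl rfl)))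
    · refine hmem _ ?_
      rw [hφ, substGL_pderiv]
      exact Ideal.sum_mem _ fun j _ ↦ Ideal.mul_mem_left _ _
        (hI (Ideal.subset_span (Or.inr ⟨j, rfl⟩)))
  refine ringKrullDim_le_of_surjective (Ideal.Quotient.lift _ _ hle) ?_
  exact Ideal.Quotient.lift_surjective_of_surjective _ _
    (Ideal.Quotient.mk_surjective.comp (substGL_surjective g))

theorem exists_mem_support_of_ringKrullDim_le {k : Type*} [Field k] {N d t : ℕ} (hd : 2 ≤ d)
    {G : MvPolynomial (Fin (N + 1)) k} (hG : G.IsHomogeneous d)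
    (hdim : ∀ I, jacobianIdeal G ≤ I →
      ringKrullDim (MvPolynomial (Fin (N + 1)) k ⧸ I) ≤ (t : WithBot ℕ∞))
    (u v : Fin (N + 1)) (huv : (u + v + t : ℕ) = N) :
    (∃ m ∈ G.support, ∀ l < u, m l = 0) ∨
      ∃ (m : Fin (N + 1) →₀ ℕ) (p : Fin (N + 1)),
        m + Finsupp.single p 1 ∈ G.support ∧ v ≤ p ∧ ∀ l < u, m l = 0 := by
  by_contra! h
  obtain ⟨h1, h2⟩ := h
  set s : Set (MvPolynomial (Fin (N + 1)) k) := X '' Set.Iio u ∪ (fun i ↦ pderiv i G) '' Set.Iio v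
    with hs
  have hX : Ideal.span (X '' Set.Iio u) ≤ Ideal.span s := Ideal.span_mono Set.subset_union_left
  have hJ : jacobianIdeal G ≤ Ideal.span s := by
    refine Ideal.span_le.mpr ?_
    rintro _ (rfl | ⟨i, rfl⟩)
    · exact hX (mem_ideal_span_X_image.mpr fun m hm ↦ h1 m hm)
    · obtain hi | hi := lt_or_ge i v
      · exact Ideal.subset_span (Or.inr ⟨i, hi, rfl⟩)
      · refine hX (mem_ideal_span_X_image.mpr fun m hm ↦ h2 m i ?_ hi)
        rw [mem_support_iff, coeff_pderiv] at hm
        exact mem_support_iff.mpr (left_ne_zero_of_mul hm)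
  have hcard : s.encard ≤ (u + v : ℕ) := by
    refine (Set.encard_union_le _ _).trans ?_
    push_cast
    refine add_le_add ((Set.encard_image_le _ _).trans_eq ?_)
      ((Set.encard_image_le _ _).trans_eq ?_) <;>
    simp [Set.encard_eq_coe_toFinset_card]
  have hconst : ∀ p ∈ s, constantCoeff p = 0 := by
    rintro _ (⟨i, -, rfl⟩ | ⟨i, -, rfl⟩)
    · exact constantCoeff_X k i
    · rw [constantCoeff_eq, coeff_pderiv, hG.coeff_eq_zero, zero_mul]
      simp
      omega
  have := (le_ringKrullDim_quotient_add_encard s hconst).trans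
    (add_le_add (hdim _ hJ) (WithBot.coe_le_coe.mpr hcard))
  have : N + 1 ≤ t + (u + v) := by exact_mod_cast this
  omega

section dehom

variable {k : Type*} [Field k] {N : ℕ}

/-- Forgetting the last exponent of a monomial. -/
noncomputable def Finsupp.dropLast (m : Fin (N + 1) →₀ ℕ) : Fin N →₀ ℕ :=
  Finsupp.equivFunOnFinite.symm fun i ↦ m i.castSucc

theorem dehom_monomial (m : Fin (N + 1) →₀ ℕ) (c : k) :
    dehom (monomial m c) = monomial m.dropLast c := by
  unfold dehom
  rw [aeval_monomial, monomial_eq, algebraMap_eq, Finsupp.prod_fintype _ _ (by simp),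
    Finsupp.prod_fintype _ _ (by simp), Fin.prod_univ_castSucc]
  simp [Finsupp.dropLast]

theorem dehom_eq_sum (G : MvPolynomial (Fin (N + 1)) k) :
    dehom G = ∑ m ∈ G.support, monomial m.dropLast (coeff m G) := by
  conv_lhs => rw [G.as_sum]
  unfold dehom
  rw [map_sum]
  exact Finset.sum_congr rfl fun m _ ↦ dehom_monomial m _

theorem exists_mem_support_sum_le_of_ord0_dehom_le {d δ : ℕ} {G : MvPolynomial (Fin (N + 1)) k}
    (hG0 : G ≠ 0) (hG : G.IsHomogeneous d) (hord : ord0 (dehom G) ≤ δ) :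
    ∃ m ∈ G.support, ∑ i : Fin N, m i.castSucc ≤ δ := by
  classical
  have hdeg : ∀ m ∈ G.support, ∑ i, m i = d := fun m hm ↦
    hG.sum_eq_of_mem_support hm
  obtain ⟨m, hm⟩ := support_nonempty.mpr hG0
  have hinj : ∀ m' ∈ G.support, m'.dropLast = m.dropLast → m' = m := fun m' hm' h ↦ by
    have hi : ∀ i : Fin N, m' i.castSucc = m i.castSucc := fun i ↦ DFunLike.congr_fun h i
    have h1 := (hdeg m' hm').trans (hdeg m hm).symm
    rw [Fin.sum_univ_castSucc, Fin.sum_univ_castSucc, Finset.sum_congr rfl fun i _ ↦ hi i] at h1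
    refine Finsupp.ext fun i ↦ ?_
    induction i using Fin.lastCases with
    | last => omega
    | cast i => exact hi i
  have hcoeff : coeff m.dropLast (dehom G) = coeff m G := by
    rw [dehom_eq_sum, coeff_sum, Finset.sum_eq_single m]
    · simp
    · intro m' hm' hne
      rw [coeff_monomial, if_neg fun h ↦ hne (hinj m' hm' h)]
    · exact fun h ↦ absurd hm h
  have hne : (dehom G).support.Nonempty :=
    ⟨m.dropLast, mem_support_iff.mpr (hcoeff ▸ mem_support_iff.mp hm)⟩
  rw [ord0, dif_pos hne, Finset.inf'_le_iff] at hord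
  obtain ⟨q, hq, hqδ⟩ := hord
  rw [dehom_eq_sum] at hq
  obtain ⟨m', hm', hq'⟩ := Finset.mem_biUnion.mp (support_sum hq)
  refine ⟨m', hm', ?_⟩
  rw [Finset.mem_singleton.mp (support_monomial_subset hq')] at hqδ
  exact hqδ

end dehom

section adeg

variable {k : Type*} [Field k] {n : ℕ}

theorem sum_mul_neg_of_adeg_neg {α : Fin n → ℤ} {G : MvPolynomial (Fin n) k}
    (h : adeg α G < 0) {m : Fin n →₀ ℕ} (hm : m ∈ G.support) :
    ∑ i, (m i : ℤ) * α i < 0 := by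
  have hne : G.support.Nonempty := ⟨m, hm⟩
  rw [adeg, dif_pos hne] at h
  exact (Finset.le_sup' (fun m : Fin n →₀ ℕ ↦ ∑ i, (m i : ℤ) * α i) hm).trans_lt h

theorem sum_mul_comp_neg_of_adeg_neg {α : Fin n → ℤ} {G : MvPolynomial (Fin n) k}
    (h : adeg α G < 0) (e : Equiv.Perm (Fin n)) {m : Fin n →₀ ℕ}
    (hm : m ∈ (rename e.symm G).support) :
    ∑ i, (m i : ℤ) * α (e i) < 0 := by
  classical
  rw [support_rename_of_injective e.symm.injective, Finset.mem_image] at hm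
  obtain ⟨m', hm', rfl⟩ := hm
  refine lt_of_eq_of_lt ?_ (sum_mul_neg_of_adeg_neg h hm')
  rw [← Equiv.sum_comp e fun i ↦ (m' i : ℤ) * α i]
  refine Finset.sum_congr rfl fun i _ ↦ ?_
  rw [← Finsupp.equivMapDomain_eq_mapDomain]
  simp

end adeg

theorem sum_mul_le_sum_mul_of_monotone {n : ℕ} {α : Fin n → ℤ} (hα : Monotone α) (u : Fin n)
    {m : Fin n → ℕ} (hm : ∀ l < u, m l = 0) :
    ((∑ i, m i : ℕ) : ℤ) * α u ≤ ∑ i, (m i : ℤ) * α i := by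
  push_cast
  rw [Finset.sum_mul]
  refine Finset.sum_le_sum fun i _ ↦ ?_
  obtain hi | hi := lt_or_ge i u
  · simp [hm i hi]
  · exact mul_le_mul_of_nonneg_left (hα hi) (Nat.cast_nonneg _)

/-- The Hilbert–Mumford inequality for one monotone weight. -/
theorem exists_mem_support_sum_mul_nonneg {k : Type*} [Field k] {N d t δ : ℕ} (hd : 2 ≤ d)
    {G : MvPolynomial (Fin (N + 1)) k} (hG0 : G ≠ 0) (hG : G.IsHomogeneous d)
    (hord : ord0 (dehom G) ≤ δ)
    (hdim : ∀ I, jacobianIdeal G ≤ I →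
      ringKrullDim (MvPolynomial (Fin (N + 1)) k ⧸ I) ≤ (t : WithBot ℕ∞))
    (hdeg : δ * min (N + 1) (t + 2) ≤ d) {α : Fin (N + 1) → ℤ} (hα : Monotone α)
    (hsum : ∑ i, α i = 0) :
    ∃ m ∈ G.support, 0 ≤ ∑ i, (m i : ℤ) * α i := by
  by_contra! hneg
  have hdegm : ∀ m ∈ G.support, ∑ i, m i = d := fun m hm ↦
    hG.sum_eq_of_mem_support hm
  have hlast : 0 ≤ α (Fin.last N) := by
    by_contra! h
    have : ∑ i, α i < 0 := Finset.sum_neg (fun i _ ↦ (hα (Fin.le_last i)).trans_lt h) ⟨0, by simp⟩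
    omega
  obtain ⟨m, hm, hmδ⟩ := exists_mem_support_sum_le_of_ord0_dehom_le hG0 hG hord
  set e := ∑ i : Fin N, m i.castSucc with he
  have hmd : e + m (Fin.last N) = d := by rw [← hdegm m hm, Fin.sum_univ_castSucc]
  have hmult : (e : ℤ) * α 0 + (d - e) * α (Fin.last N) < 0 := by
    refine lt_of_le_of_lt ?_ (hneg m hm)
    rw [Fin.sum_univ_castSucc, ← hmd, he]
    push_cast
    rw [Finset.sum_mul, add_sub_cancel_left]
    gcongr with i
    exact hα (Fin.zero_le _)
  have h0last : α 0 ≤ α (Fin.last N) := hα (Fin.zero_le _)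
  have hmin : (δ : ℤ) * (α 0 + (min (N + 1) (t + 2) - 1) * α (Fin.last N)) < 0 := by
    have h1 : (e : ℤ) ≤ δ := by exact_mod_cast hmδ
    have h2 : (δ : ℤ) * min (N + 1) (t + 2) ≤ d := by exact_mod_cast hdeg
    nlinarith [mul_nonneg (sub_nonneg.mpr h1) (sub_nonneg.mpr h0last),
      mul_nonneg (sub_nonneg.mpr h2) hlast]
  replace hmin := neg_of_mul_neg_right hmin (Int.natCast_nonneg δ)
  obtain hNt | hNt := le_or_gt (N + 1) (t + 2)
  · rw [min_eq_left (by exact_mod_cast hNt)] at hmin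
    rw [Fin.sum_univ_succ] at hsum
    have : ∑ i : Fin N, α i.succ ≤ N * α (Fin.last N) := by
      refine (Finset.sum_le_card_nsmul _ _ _ fun i _ ↦ hα (Fin.le_last i.succ)).trans_eq ?_
      simp
    push_cast at hmin
    linarith
  · rw [min_eq_right (by exact_mod_cast hNt.le)] at hmin
    have hpair' : ∀ u v : Fin (N + 1), (u + v + t : ℕ) = N → 0 ≤ α u → α u + α v < 0 := by
      intro u v huv hu
      obtain ⟨m, hm, hmu⟩ | ⟨m, p, hm, hp, hmu⟩ :=
        exists_mem_support_of_ringKrullDim_le hd hG hdim u v huv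
      · have h1 := (sum_mul_le_sum_mul_of_monotone hα u hmu).trans_lt (hneg m hm)
        exact absurd h1 (not_lt.mpr (mul_nonneg (Nat.cast_nonneg _) hu))
      · have h1 := sum_mul_le_sum_mul_of_monotone hα u hmu
        have h2 := hneg _ hm
        have h3 := hdegm _ hm
        simp only [Finsupp.add_apply, Finset.sum_add_distrib, Nat.cast_add, add_mul,
          Finsupp.single_apply, Finset.sum_ite_eq, Finset.mem_univ, if_true, Nat.cast_ite,
          Nat.cast_one, Nat.cast_zero, ite_mul, one_mul, zero_mul] at h2 h3
        have h4 : (1 : ℤ) ≤ ((∑ i, m i : ℕ) : ℤ) := by omega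
        have h5 := hα hp
        nlinarith [mul_nonneg (sub_nonneg.mpr h4) hu]
    have hpair : ∀ u v : Fin (N + 1), (u + v + t : ℕ) = N → α u + α v ≤ 0 := by
      intro u v huv
      obtain hu | hu := le_or_gt 0 (α u)
      · exact (hpair' u v huv hu).le
      obtain hv | hv := le_or_gt 0 (α v)
      · linarith [hpair' v u (by omega) hv]
      · linarith
    obtain ⟨c, rfl⟩ : ∃ c, N = c + t := ⟨N - t, by omega⟩
    have hcast : ∀ i (hi : i < c + t + 1), Fin.ofNat (c + t + 1) i = ⟨i, hi⟩ := fun i hi ↦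
      Fin.ext (Nat.mod_eq_of_lt hi)
    have hlt := sum_range_neg_of_pairing (f := fun i ↦ α (Fin.ofNat (c + t + 1) i)) (c := c)
      (t := t) (by omega) (fun i hi ↦ hα ?_) (fun u v huv ↦ ?_) ?_
    · rw [← Fin.sum_univ_eq_sum_range] at hlt
      simp at hlt
      omega
    · rw [hcast _ (by omega), hcast _ (by omega)]
      exact hi
    · rw [hcast u (by omega), hcast v (by omega)]
      exact hpair _ _ (by simp; omega)
    · rw [hcast 0 (by omega), hcast (c + t) (by omega)]
      have : (⟨c + t, by omega⟩ : Fin (c + t + 1)) = Fin.last _ := rfl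
      rw [this]
      refine lt_of_eq_of_lt ?_ hmin
      rw [Fin.mk_zero']
      push_cast
      ring

/-- If the multiplicity of `H = {F = 0}` at every point is at most `δ`,
`dim H_sing ≤ s`, and `d ≥ δ · min(N+1, s+3)`, then `F` satisfies the
Hilbert–Mumford criterion for semistability, i.e. `H` is semistable. -/
theorem semistable_of_deg_ge_mult_mul_min {k : Type*} [Field k] [IsAlgClosed k]
    {N d : ℕ} (hN : 1 ≤ N) (hd : 2 ≤ d)
    (F : MvPolynomial (Fin (N+1)) k) (hF0 : F ≠ 0) (hFhom : F.IsHomogeneous d)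
    (δ : ℕ) (hδ : 1 ≤ δ)
    (hmult : ∀ h : Matrix.GeneralLinearGroup (Fin (N+1)) k,
      ord0 (dehom (substGL (↑h) F)) ≤ δ)
    (s : ℤ) (hs : -1 ≤ s)
    (hsing : ringKrullDim (MvPolynomial (Fin (N+1)) k ⧸ jacobianIdeal F)
      ≤ ((s+1).toNat : WithBot ℕ∞))
    (hdeg : (δ : ℤ) * min ((N : ℤ) + 1) (s + 3) ≤ (d : ℤ)) :
    ∀ g : Matrix.GeneralLinearGroup (Fin (N+1)) k, ∀ α : Fin (N+1) → ℤ,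
      α ≠ 0 → (∑ i, α i) = 0 → 0 ≤ adeg α (substGL (↑g) F) := by
  intro g α _ hsum
  by_contra! hneg
  obtain ⟨t, rfl⟩ : ∃ t : ℕ, s = t - 1 := ⟨(s + 1).toNat, by omega⟩
  set e := Tuple.sort α
  obtain ⟨g', hg'⟩ := exists_substGL_eq_rename g e.symm
  have hdim : ∀ I, jacobianIdeal (substGL (g' : Matrix (Fin (N + 1)) (Fin (N + 1)) k) F) ≤ I →
      ringKrullDim (MvPolynomial (Fin (N + 1)) k ⧸ I) ≤ (t : WithBot ℕ∞) := fun I hI ↦ by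
    refine (ringKrullDim_quotient_le_of_jacobianIdeal_substGL_le F g' hI).trans ?_
    simpa using hsing
  have hdeg' : δ * min (N + 1) (t + 2) ≤ d := by
    rw [show (t : ℤ) - 1 + 3 = t + 2 by ring] at hdeg
    exact_mod_cast hdeg
  obtain ⟨m, hm, hm0⟩ := exists_mem_support_sum_mul_nonneg hd (substGL_ne_zero g' hF0)
    (isHomogeneous_substGL _ hFhom) (hmult g') hdim hdeg' (Tuple.monotone_sort α)
    ((Equiv.sum_comp e α).trans hsum)
  rw [hg'] at hm
  exact absurd hm0 (not_le.mpr (sum_mul_comp_neg_of_adeg_neg hneg e hm))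
end

section
/- Assume N ≥ 2. Let g ∈ GL_{N+1}(k) and let α = (α_0,…,α_N) ∈ ℤ^{N+1} \ {0} satisfy α_0 ≤ ⋯ ≤ α_N and Σ_{i=0}^N α_i = 0. Assume f_g(0,…,0) = 0, let δ_P := ord_0(f_g) ≥ 1, and assume that the lowest-degree homogeneous part in_{δ_P}(f_g) is not a scalar multiple of x_0^{δ_P} (this holds in particular when the support of the projective tangent cone of H at P = g([0:⋯:0:1]) is not a projective hyperplane of P(T_P P^N_k) ≅ P^{N−1}_k). Then deg_α(F∘g) ≥ (d − 2δ_P + 1)·α_N − (δ_P − 2)·α_1 − (δ_P − 1)·Σ_{i=2}^{N−1} α_i. -/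
open MvPolynomial

theorem MvPolynomial.IsHomogeneous.substGL {k : Type*} [CommRing k] {n d : ℕ}
    {F : MvPolynomial (Fin n) k} (hF : F.IsHomogeneous d) (g : Matrix (Fin n) (Fin n) k) :
    (substGL g F).IsHomogeneous d := by
  have h := hF.aeval (fun i => ∑ j, C (g i j) * X j) (n := 1) fun i =>
    IsHomogeneous.sum _ _ _ fun j _ => by
      simpa using (isHomogeneous_C (Fin n) (g i j)).mul (isHomogeneous_X k j)
  simpa [_root_.substGL] using h

/-- Every monomial of a dehomogenization is the restriction of a monomial of the polynomial. -/
theorem exists_mem_support_of_mem_support_dehom {k : Type*} [CommRing k] {N : ℕ}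
    {G : MvPolynomial (Fin (N + 1)) k} {m : Fin N →₀ ℕ} (hm : m ∈ (dehom G).support) :
    ∃ M ∈ G.support, ∀ i : Fin N, M i.castSucc = m i := by
  have hG : dehom G = ∑ M ∈ G.support,
      monomial (Finsupp.equivFunOnFinite.symm fun i : Fin N => M i.castSucc) (coeff M G) := by
    rw [dehom, aeval_def, eval₂_eq']
    refine Finset.sum_congr rfl fun M _ => ?_
    rw [Fin.prod_univ_castSucc, monomial_eq, Finsupp.prod_fintype _ _ (by simp)]
    simp [algebraMap_eq]
  rw [hG] at hm
  obtain ⟨M, hM, hmM⟩ := Finset.mem_biUnion.1 (support_sum hm)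
  refine ⟨M, hM, fun i => ?_⟩
  rw [Finset.mem_singleton.1 (support_monomial_subset hmM)]
  simp

theorem le_adeg {k : Type*} [CommSemiring k] {n : ℕ} (α : Fin n → ℤ)
    {G : MvPolynomial (Fin n) k} {M : Fin n →₀ ℕ} (hM : M ∈ G.support) :
    ∑ i, (M i : ℤ) * α i ≤ adeg α G := by
  rw [adeg, dif_pos ⟨M, hM⟩]
  exact Finset.le_sup' (fun m : Fin n →₀ ℕ => ∑ i, (m i : ℤ) * α i) hM

/-- A homogeneous polynomial that is not a scalar multiple of a power of `X a` has a monomial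
involving another variable. -/
theorem exists_mem_support_of_ne_C_mul_X_pow {k σ : Type*} [CommSemiring k]
    {f : MvPolynomial σ k} {e : ℕ} (hf : f.IsHomogeneous e) (a : σ)
    (hne : ∀ c : k, f ≠ C c * X a ^ e) :
    ∃ m ∈ f.support, ∃ j ≠ a, m j ≠ 0 := by
  classical
  by_contra! h
  have hsupp : ∀ m ∈ f.support, m = Finsupp.single a e := by
    intro m hm
    have hma : m = Finsupp.single a (m a) := by
      ext j
      by_cases hj : j = a
      · simp [hj]
      · simp [h m hm j hj, Ne.symm hj]
    have hdeg : m.degree = e := by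
      rw [Finsupp.degree_eq_weight_one]
      exact hf (mem_support_iff.1 hm)
    rw [hma, Finsupp.degree_single] at hdeg
    rw [hma, hdeg]
  refine hne (coeff (Finsupp.single a e) f) ?_
  rw [C_mul_X_pow_eq_monomial]
  ext m
  rw [coeff_monomial]
  split_ifs with hm
  · rw [hm]
  · exact notMem_support_iff.1 fun hmem => hm (hsupp m hmem).symm

/-- A nonnegative combination of an increasing sequence that involves an index beyond the first
is bounded below by its first two terms. -/
theorem Monotone.le_sum_mul_of_ne_zero {n : ℕ} {β : Fin (n + 2) → ℤ} (hβ : Monotone β)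
    (m : Fin (n + 2) → ℕ) {j : Fin (n + 2)} (hj : j ≠ 0) (hmj : m j ≠ 0) :
    ((∑ i, m i : ℕ) - 1 : ℤ) * β 0 + β 1 ≤ ∑ i, (m i : ℤ) * β i := by
  have h1 : β 1 ≤ β j := hβ (Fin.one_le_of_ne_zero hj)
  have h2 : (m j : ℤ) * (β j - β 0) ≤ ∑ i, (m i : ℤ) * (β i - β 0) :=
    Finset.single_le_sum (f := fun i => (m i : ℤ) * (β i - β 0))
      (fun i _ => mul_nonneg (by positivity) (sub_nonneg.2 (hβ (Fin.zero_le i))))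
      (Finset.mem_univ j)
  have h3 : ∑ i, (m i : ℤ) * (β i - β 0)
      = ∑ i, (m i : ℤ) * β i - (∑ i, m i : ℕ) * β 0 := by
    simp [mul_sub, Finset.sum_sub_distrib, Finset.sum_mul]
  have h4 : (1 : ℤ) ≤ m j := by exact_mod_cast Nat.one_le_iff_ne_zero.2 hmj
  have h5 : 0 ≤ β j - β 0 := sub_nonneg.2 (hβ (Fin.zero_le j))
  nlinarith

theorem sum_eq_first_two_add_last_add_sum_middle {M : Type*} [AddCommMonoid M] {n : ℕ}
    (α : Fin (n + 3) → M) :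
    ∑ i, α i = α 0 + α 1 + α (Fin.last (n + 2)) + ∑ i ∈ Finset.univ.filter
      (fun i : Fin (n + 3) => 2 ≤ (i : ℕ) ∧ (i : ℕ) ≤ n + 1), α i := by
  rw [← Finset.sum_filter_not_add_sum_filter Finset.univ
    (fun i : Fin (n + 3) => 2 ≤ (i : ℕ) ∧ (i : ℕ) ≤ n + 1)]
  congr 1
  have h : Finset.univ.filter (fun i : Fin (n + 3) => ¬(2 ≤ (i : ℕ) ∧ (i : ℕ) ≤ n + 1))
      = {0, 1, Fin.last (n + 2)} := by
    ext i
    have := i.isLt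
    simp only [Finset.mem_filter, Finset.mem_univ, true_and, Finset.mem_insert,
      Finset.mem_singleton, Fin.ext_iff, Fin.val_zero, Fin.val_one, Fin.val_last]
    omega
  rw [h, Finset.sum_insert, Finset.sum_pair, add_assoc] <;> simp [Fin.ext_iff]

/-- Assume `N ≥ 2`. If `P = g([0:⋯:0:1])` lies on `H = {F = 0}`, `δP` is the
multiplicity of `H` at `P`, and the lowest-degree homogeneous part of `f_g` is not a
scalar multiple of `x_0^δP` (in particular, if the support of the projective tangent
cone of `H` at `P` is not a projective hyperplane), then
`deg_α (F∘g) ≥ (d - 2δP + 1)·α_N - (δP - 2)·α_1 - (δP - 1)·∑_{i=2}^{N-1} α_i`. -/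
theorem adeg_ge_of_tangentCone_not_hyperplane {k : Type*} [Field k] [IsAlgClosed k]
    {N d : ℕ} (hN : 2 ≤ N) (hd : 2 ≤ d)
    (F : MvPolynomial (Fin (N+1)) k) (hF0 : F ≠ 0) (hFhom : F.IsHomogeneous d)
    (g : Matrix.GeneralLinearGroup (Fin (N+1)) k)
    (α : Fin (N+1) → ℤ) (hα0 : α ≠ 0) (hmono : Monotone α) (hsum : ∑ i, α i = 0)
    (heval : MvPolynomial.eval (fun _ : Fin N => (0 : k)) (dehom (substGL (↑g) F)) = 0)
    (δP : ℕ) (hδP : δP = ord0 (dehom (substGL (↑g) F)))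
    (hnot : ∀ c : k,
      MvPolynomial.homogeneousComponent δP (dehom (substGL (↑g) F))
        ≠ MvPolynomial.C c * (MvPolynomial.X (⟨0, by omega⟩ : Fin N)) ^ δP) :
    ((d : ℤ) - 2 * δP + 1) * α (Fin.last N)
      - ((δP : ℤ) - 2) * α ⟨1, by omega⟩
      - ((δP : ℤ) - 1) * (∑ i ∈ Finset.univ.filter
          (fun i : Fin (N+1) => 2 ≤ (i : ℕ) ∧ (i : ℕ) ≤ N - 1), α i)
      ≤ adeg α (substGL (↑g) F) := by
  obtain ⟨n, rfl⟩ : ∃ n, N = n + 2 := ⟨N - 2, by omega⟩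
  obtain ⟨m, hm, j, hj, hmj⟩ := exists_mem_support_of_ne_C_mul_X_pow
    (homogeneousComponent_isHomogeneous δP _) _ hnot
  rw [mem_support_iff, coeff_homogeneousComponent] at hm
  obtain ⟨hdeg, hcoeff⟩ := ite_ne_right_iff.1 hm
  obtain ⟨M, hM, hMm⟩ := exists_mem_support_of_mem_support_dehom (mem_support_iff.2 hcoeff)
  have hMdeg : ∑ i, M i = d := by
    rw [← Finsupp.degree_eq_sum, Finsupp.degree_eq_weight_one]
    exact hFhom.substGL _ (mem_support_iff.1 hM)
  rw [Finsupp.degree_eq_sum] at hdeg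
  rw [Fin.sum_univ_castSucc] at hMdeg
  simp only [hMm, hdeg] at hMdeg
  have hadeg := le_adeg α hM
  rw [Fin.sum_univ_castSucc] at hadeg
  simp only [hMm] at hadeg
  have hlow := (hmono.comp Fin.strictMono_castSucc.monotone).le_sum_mul_of_ne_zero m hj hmj
  rw [hdeg] at hlow
  rw [sum_eq_first_two_add_last_add_sum_middle] at hsum
  change _ - _ * α 1 - _ * (∑ i ∈ Finset.univ.filter
    (fun i : Fin (n + 3) => 2 ≤ (i : ℕ) ∧ (i : ℕ) ≤ n + 1), α i) ≤ _
  change ((δP : ℤ) - 1) * α 0 + α 1 ≤ ∑ i, (m i : ℤ) * α i.castSucc at hlow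
  have hlast : (M (Fin.last (n + 2)) : ℤ) = d - δP := by omega
  rw [hlast] at hadeg
  linear_combination hadeg + hlow - ((δP : ℤ) - 1) * hsum
end

section
/- Let α = (α_0,…,α_N) ∈ ℤ^{N+1} \ {0} satisfy α_0 ≤ ⋯ ≤ α_N and Σ_{i=0}^N α_i = 0, and let u, v ∈ ℕ with u ≤ v and u + v ≤ N. Write F = Σ_{i=0}^N X_i·P_i as the unique decomposition in which, for each i, P_i is a homogeneous polynomial of degree d−1 in the variables X_i,…,X_N only. If deg_α F < α_u + (d−1)·α_v, then F and all the partial derivatives ∂F/∂X_i for 0 ≤ i ≤ N belong to the ideal of k[X_0,…,X_N] generated by X_0,…,X_{v−1}, P_0,…,P_{u−1}; equivalently, the closed subscheme Z of P^N_k defined by the equations X_0 = ⋯ = X_{v−1} = P_0 = ⋯ = P_{u−1} = 0 is contained in H_sing ∩ {X_0 = ⋯ = X_{v−1} = 0}. -/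
open MvPolynomial

/-- The monomials of `X i * P`, for `P` a polynomial in the variables of index at least `i`,
involve `X i` and no variable of smaller index. -/
lemma apply_of_mem_support_X_mul {k σ : Type*} [CommSemiring k] [LinearOrder σ] {i : σ}
    {P : MvPolynomial σ k} (hP : ∀ m ∈ P.support, ∀ j < i, m j = 0) {m : σ →₀ ℕ}
    (hm : m ∈ (X i * P).support) : m i ≠ 0 ∧ ∀ j < i, m j = 0 := by
  classical
  rw [support_X_mul, Finset.mem_map] at hm
  obtain ⟨m', hm', rfl⟩ := hm
  refine ⟨by simp, fun j hj => ?_⟩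
  simp [hP m' hm' j hj, hj.ne']

/-- No cancellation occurs between the summands of `∑ i, X i * P i` when each `P i` only
involves the variables of index at least `i`. -/
lemma support_X_mul_subset_support_sum {k σ : Type*} [CommSemiring k] [LinearOrder σ]
    [Fintype σ] {P : σ → MvPolynomial σ k}
    (hP : ∀ i, ∀ m ∈ (P i).support, ∀ j < i, m j = 0) (i : σ) :
    (X i * P i).support ⊆ (∑ l, X l * P l).support := by
  intro m hm
  have hi := apply_of_mem_support_X_mul (hP i) hm
  rw [mem_support_iff, coeff_sum, Finset.sum_eq_single i]
  · exact mem_support_iff.1 hm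
  · intro l _ hli
    by_contra h
    have hl := apply_of_mem_support_X_mul (hP l) (mem_support_iff.2 h)
    rcases lt_or_gt_of_ne hli with h' | h'
    · exact hl.1 (hi.2 l h')
    · exact hi.1 (hl.2 i h')
  · simp

/-- The weight of any monomial of `G` is at most its `α`-degree. -/
lemma sum_mul_le_adeg {k : Type*} [CommSemiring k] {n : ℕ} (α : Fin n → ℤ)
    {G : MvPolynomial (Fin n) k} {m : Fin n →₀ ℕ} (hm : m ∈ G.support) :
    ∑ i, (m i : ℤ) * α i ≤ adeg α G := by
  rw [adeg, dif_pos ⟨m, hm⟩]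
  exact Finset.le_sup' (fun m : Fin n →₀ ℕ => ∑ i, (m i : ℤ) * α i) hm

/-- A monomial of degree `d` in the variables of index at least `u`, of degree at most one in the
variables of index less than `v`, has weight at least `α u + (d - 1) * α v`. -/
lemma add_mul_le_sum_mul {n : ℕ} {α : Fin n → ℤ} (hα : Monotone α) {u v : Fin n} (huv : u ≤ v)
    (m : Fin n →₀ ℕ) (hmu : ∀ j < u, m j = 0) (hmv : ∑ j with j < v, m j ≤ 1) :
    α u + ((∑ j, m j : ℕ) - 1 : ℤ) * α v ≤ ∑ j, (m j : ℤ) * α j := by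
  have hlow : ((∑ j with j < v, m j : ℕ) : ℤ) * α u ≤ ∑ j with j < v, (m j : ℤ) * α j := by
    rw [Nat.cast_sum, Finset.sum_mul]
    refine Finset.sum_le_sum fun j _ => ?_
    rcases lt_or_ge j u with h | h
    · simp [hmu j h]
    · exact mul_le_mul_of_nonneg_left (hα h) (Nat.cast_nonneg _)
  have hhigh : ((∑ j with ¬ j < v, m j : ℕ) : ℤ) * α v ≤
      ∑ j with ¬ j < v, (m j : ℤ) * α j := by
    rw [Nat.cast_sum, Finset.sum_mul]
    refine Finset.sum_le_sum fun j hj => ?_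
    exact mul_le_mul_of_nonneg_left (hα (not_lt.1 (Finset.mem_filter.1 hj).2))
      (Nat.cast_nonneg _)
  rw [← Finset.sum_filter_add_sum_filter_not Finset.univ (· < v) (fun j => (m j : ℤ) * α j),
    ← Finset.sum_filter_add_sum_filter_not Finset.univ (· < v) (fun j => m j)]
  have huv' := hα huv
  have hmv' : ((∑ j with j < v, m j : ℕ) : ℤ) ≤ 1 := by exact_mod_cast hmv
  rw [Nat.cast_add]
  nlinarith [mul_nonneg (sub_nonneg.2 hmv') (sub_nonneg.2 huv')]

/-- If every monomial of `G` has degree at least two in the variables indexed by `s`, then the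
partial derivatives of `G` belong to the ideal generated by these variables. -/
lemma pderiv_mem_span_X_image {k σ : Type*} [CommSemiring k] {s : Finset σ}
    {G : MvPolynomial σ k} (hG : ∀ m ∈ G.support, 2 ≤ ∑ j ∈ s, m j) (i : σ) :
    pderiv i G ∈ Ideal.span ((X : σ → MvPolynomial σ k) '' s) := by
  classical
  rw [G.as_sum, map_sum]
  refine Ideal.sum_mem _ fun m hm => ?_
  rw [pderiv_monomial, mem_ideal_span_X_image]
  intro m' hm'
  obtain rfl := Finset.mem_singleton.1 (support_monomial_subset hm')
  by_contra! h
  have hle : ∑ j ∈ s, m j ≤ ∑ j ∈ s, Finsupp.single i 1 j :=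
    Finset.sum_le_sum fun j hj => Nat.sub_eq_zero_iff_le.1 (h j hj)
  have hone : ∑ j ∈ s, Finsupp.single i 1 j ≤ 1 := by
    simp only [Finsupp.single_apply, Finset.sum_ite_eq]
    split_ifs <;> simp
  have := hG m hm
  omega

/-- Write `F = ∑ i, X_i · P_i` where each `P_i` is homogeneous of degree `d-1` in the
variables `X_i, …, X_N` only, and let `u ≤ v` with `u + v ≤ N`. If
`deg_α F < α_u + (d-1)·α_v`, then `F` and all its partial derivatives belong to the
ideal generated by `X_0, …, X_{v-1}, P_0, …, P_{u-1}`; equivalently, the closed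
subscheme `Z = {X_0 = ⋯ = X_{v-1} = P_0 = ⋯ = P_{u-1} = 0}` of `P^N_k` is contained
in `H_sing ∩ {X_0 = ⋯ = X_{v-1} = 0}`. -/
theorem singular_on_Z_of_adeg_lt {k : Type*} [Field k] [IsAlgClosed k]
    {N d : ℕ} (hN : 1 ≤ N) (hd : 2 ≤ d)
    (F : MvPolynomial (Fin (N+1)) k) (hF0 : F ≠ 0) (hFhom : F.IsHomogeneous d)
    (α : Fin (N+1) → ℤ) (hα0 : α ≠ 0) (hmono : Monotone α) (hsum : ∑ i, α i = 0)
    (u v : ℕ) (huv : u ≤ v) (huvN : u + v ≤ N)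
    (P : Fin (N+1) → MvPolynomial (Fin (N+1)) k)
    (hPhom : ∀ i, (P i).IsHomogeneous (d - 1))
    (hPvar : ∀ i, ∀ m ∈ (P i).support, ∀ j : Fin (N+1), j < i → m j = 0)
    (hFdec : F = ∑ i, MvPolynomial.X i * P i)
    (hdeg : adeg α F < α ⟨u, by omega⟩ + ((d : ℤ) - 1) * α ⟨v, by omega⟩) :
    F ∈ Ideal.span
        ((fun j : Fin (N+1) => (MvPolynomial.X j : MvPolynomial (Fin (N+1)) k)) ''
            {j : Fin (N+1) | (j : ℕ) < v}
          ∪ P '' {i : Fin (N+1) | (i : ℕ) < u})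
    ∧ ∀ i : Fin (N+1), pderiv i F ∈ Ideal.span
        ((fun j : Fin (N+1) => (MvPolynomial.X j : MvPolynomial (Fin (N+1)) k)) ''
            {j : Fin (N+1) | (j : ℕ) < v}
          ∪ P '' {i : Fin (N+1) | (i : ℕ) < u}) := by
  set I := Ideal.span
        ((fun j : Fin (N+1) => (MvPolynomial.X j : MvPolynomial (Fin (N+1)) k)) ''
            {j : Fin (N+1) | (j : ℕ) < v}
          ∪ P '' {i : Fin (N+1) | (i : ℕ) < u})
  have hX : ∀ j : Fin (N+1), (j : ℕ) < v → (X j : MvPolynomial (Fin (N+1)) k) ∈ I :=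
    fun j hj => Ideal.subset_span (Or.inl ⟨j, hj, rfl⟩)
  have hPI : ∀ i : Fin (N+1), (i : ℕ) < u → P i ∈ I :=
    fun i hi => Ideal.subset_span (Or.inr ⟨i, hi, rfl⟩)
  let s : Finset (Fin (N+1)) := {j | j < ⟨v, by omega⟩}
  have hs : Ideal.span ((X : Fin (N+1) → MvPolynomial (Fin (N+1)) k) '' s) ≤ I := by
    rw [Ideal.span_le]
    rintro _ ⟨j, hj, rfl⟩
    exact hX j (by simpa [s, Fin.lt_def] using hj)
  have htwo : ∀ i : Fin (N+1), u ≤ (i : ℕ) → ∀ m ∈ (X i * P i).support, 2 ≤ ∑ j ∈ s, m j := by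
    intro i hi m hm
    by_contra! hlt
    have hmF : m ∈ F.support := hFdec ▸ support_X_mul_subset_support_sum hPvar i hm
    have hmd : ∑ j, m j = d := by
      rw [← hFhom (mem_support_iff.1 hmF)]
      simp [Finsupp.weight_apply, Finsupp.sum_fintype]
    have hle := add_mul_le_sum_mul hmono (u := ⟨u, by omega⟩) (v := ⟨v, by omega⟩) huv m
      (fun j hj => (apply_of_mem_support_X_mul (hPvar i) hm).2 j (lt_of_lt_of_le hj hi))
      (Nat.le_of_lt_succ hlt)
    rw [hmd] at hle
    exact (hle.trans (sum_mul_le_adeg α hmF)).not_gt hdeg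
  refine ⟨?_, fun j => ?_⟩
  · rw [hFdec]
    refine Ideal.sum_mem _ fun i _ => ?_
    rcases lt_or_ge (i : ℕ) u with hi | hi
    · exact Ideal.mul_mem_left _ _ (hPI i hi)
    · refine hs (mem_ideal_span_X_image.2 fun m hm => ?_)
      refine Finset.exists_ne_zero_of_sum_ne_zero ?_
      have := htwo i hi m hm
      omega
  · rw [hFdec, map_sum]
    refine Ideal.sum_mem _ fun i _ => ?_
    rcases lt_or_ge (i : ℕ) u with hi | hi
    · rw [Derivation.leibniz, smul_eq_mul, smul_eq_mul]
      exact I.add_mem (I.mul_mem_right _ (hX i (hi.trans_le huv))) (I.mul_mem_right _ (hPI i hi))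
    · exact hs (pderiv_mem_span_X_image (htwo i hi) j)
end
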